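/- arXiv:1403.3354 — 9 statements merged into one kernel-verified Lean document; each statement's English description precedes it below -/
import Mathlib

section
/- Let L be a residuated basic algebra. For all a, b, c ∈ L, a·(b·c) ≤ (a·b)·c (semi-associativity of the product). -/
/-- A residuated basic algebra: a bounded distributive lattice with a product `mul`,
its right residual `rimp` and left residual `limp` satisfying the residuation law,
weakening `w₁`, `w₂` and restricted contraction `c_r`. -/
class ResiduatedBasicAlgebra (L : Type*) extends DistribLattice L, BoundedOrder L where
  mul : L → L → L
  rimp : L → L → L
  limp : L → L → L
  res_r : ∀ a b c : L, mul a b ≤ c ↔ b ≤ rimp a c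
  res_l : ∀ a b c : L, mul a b ≤ c ↔ a ≤ limp c b
  w₁ : ∀ a : L, mul a ⊤ ≤ a
  w₂ : ∀ a : L, mul ⊤ a ≤ a
  c_r : ∀ a b : L, mul a b ≤ mul (mul a b) b

open ResiduatedBasicAlgebra

namespace ResiduatedBasicAlgebra

variable {L : Type*} [ResiduatedBasicAlgebra L]

theorem mul_mono {a a' b b' : L} (ha : a ≤ a') (hb : b ≤ b') : mul a b ≤ mul a' b' :=
  (res_l _ _ _).2 (ha.trans ((res_l _ _ _).1 ((res_r _ _ _).2 (hb.trans ((res_r _ _ _).1 le_rfl)))))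

theorem mul_le_left (a b : L) : mul a b ≤ a :=
  (mul_mono le_rfl le_top).trans (w₁ a)

theorem mul_le_right (a b : L) : mul a b ≤ b :=
  (mul_mono le_top le_rfl).trans (w₂ b)

end ResiduatedBasicAlgebra

/-- Semi-associativity: `a·(b·c) ≤ (a·b)·c`. -/
theorem mul_semiassoc {L : Type*} [ResiduatedBasicAlgebra L] (a b c : L) :
    mul a (mul b c) ≤ mul (mul a b) c :=
  (c_r a (mul b c)).trans
    (mul_mono (mul_mono le_rfl (mul_le_left b c)) (mul_le_right b c))
end

section
/- Let L be a residuated basic algebra. For all a, b, c ∈ L, (a → b) ⊓ (b → c) ≤ a → c. Consequently (together with the identities a → (b ⊓ c) = (a → b) ⊓ (a → c), (b ⊔ c) → a = (b → a) ⊓ (c → a), a → a = ⊤, and the inequality a ≤ ⊤ → a), the reduct (L, ⊓, ⊔, ⊤, ⊥, →) of any residuated basic algebra is a basic algebra. -/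
open ResiduatedBasicAlgebra

theorem ResiduatedBasicAlgebra.mul_le_mul_of_le_left {L : Type*} [ResiduatedBasicAlgebra L]
    {a b : L} (h : a ≤ b) (x : L) :
    mul a x ≤ mul b x :=
  (res_l _ _ _).2 (h.trans ((res_l _ _ _).1 le_rfl))

theorem ResiduatedBasicAlgebra.rimp_trans {L : Type*} [ResiduatedBasicAlgebra L] (a b c : L) :
    rimp a b ⊓ rimp b c ≤ rimp a c :=
  (res_r _ _ _).1 <| (c_r _ _).trans <|
    (mul_le_mul_of_le_left ((res_r _ _ _).2 inf_le_left) _).trans ((res_r _ _ _).2 inf_le_right)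

theorem ResiduatedBasicAlgebra.rimp_inf {L : Type*} [ResiduatedBasicAlgebra L] (a b c : L) :
    rimp a (b ⊓ c) = rimp a b ⊓ rimp a c :=
  eq_of_forall_le_iff fun x => by simp only [le_inf_iff, ← res_r]

theorem ResiduatedBasicAlgebra.sup_rimp {L : Type*} [ResiduatedBasicAlgebra L] (a b c : L) :
    rimp (b ⊔ c) a = rimp b a ⊓ rimp c a :=
  eq_of_forall_le_iff fun x => by simp only [le_inf_iff, ← res_r, res_l, sup_le_iff]

/-- `(a → b) ⊓ (b → c) ≤ a → c`; consequently, together with the other listed laws,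
the reduct `(L, ⊓, ⊔, ⊤, ⊥, →)` of a residuated basic algebra satisfies all axioms
of a basic algebra. -/
theorem rimp_trans_and_basic_algebra_reduct {L : Type*} [ResiduatedBasicAlgebra L] :
    (∀ a b c : L, rimp a b ⊓ rimp b c ≤ rimp a c) ∧
    (∀ a b c : L, rimp a (b ⊓ c) = rimp a b ⊓ rimp a c) ∧
    (∀ a b c : L, rimp (b ⊔ c) a = rimp b a ⊓ rimp c a) ∧
    (∀ a : L, rimp a a = ⊤) ∧
    (∀ a : L, a ≤ rimp ⊤ a) := by
  exact ⟨rimp_trans, rimp_inf, sup_rimp, fun a => top_le_iff.1 ((res_r _ _ _).1 (w₁ a)),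
    fun a => (res_r _ _ _).1 (w₂ a)⟩
end

section
/- Let L be a residuated basic algebra. For all a, b ∈ L, ⊤·(a ⊓ b) ≤ (⊤·a)·b. -/
open ResiduatedBasicAlgebra

namespace ResiduatedBasicAlgebra

theorem mul_mono_s11 {L : Type*} [ResiduatedBasicAlgebra L] {a b c d : L} (hab : a ≤ b)
    (hcd : c ≤ d) : mul a c ≤ mul b d :=
  (res_l a c (mul b d)).2 <| hab.trans <| (res_l b c (mul b d)).1 <|
    (res_r b c (mul b d)).2 <| hcd.trans <| (res_r b d (mul b d)).1 le_rfl

end ResiduatedBasicAlgebra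

/-- `⊤·(a ⊓ b) ≤ (⊤·a)·b`. -/
theorem top_mul_inf_le {L : Type*} [ResiduatedBasicAlgebra L] (a b : L) :
    mul ⊤ (a ⊓ b) ≤ mul (mul ⊤ a) b := by
  exact (c_r ⊤ (a ⊓ b)).trans (mul_mono_s11 (mul_mono_s11 le_rfl inf_le_left) inf_le_right)
end

section
/- Let L be a residuated basic algebra. For all a, b ∈ L, ⊤·(a ⊓ (a → b)) ≤ b; equivalently, a ⊓ (a → b) ≤ ⊤ → b. (This is the algebraic content of the BPL theorem p∧(p→q) → (⊤→q).) -/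
open ResiduatedBasicAlgebra

/-- `⊤·(a ⊓ (a → b)) ≤ b`; equivalently, `a ⊓ (a → b) ≤ ⊤ → b`. -/
theorem top_mul_inf_rimp_le {L : Type*} [ResiduatedBasicAlgebra L] (a b : L) :
    mul ⊤ (a ⊓ rimp a b) ≤ b ∧ a ⊓ rimp a b ≤ rimp ⊤ b := by
  have h : mul ⊤ (a ⊓ rimp a b) ≤ b :=
    calc mul ⊤ (a ⊓ rimp a b)
      _ ≤ mul (mul ⊤ (a ⊓ rimp a b)) (a ⊓ rimp a b) := c_r _ _
      _ ≤ b := (res_l _ _ _).2 <| (w₂ _).trans <| inf_le_left.trans <|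
        (res_l _ _ _).1 <| (res_r _ _ _).2 inf_le_right
  exact ⟨h, (res_r _ _ _).1 h⟩
end

section
/- Let M = (W, R, V) be a BPL-model and let J^M be the induced S*_RBL-model. Then for every BPL formula A, every a ∈ W, and every i ∈ {1,2}: M, a ⊨ A if and only if J^M, (a,i) ⊨ A. -/
/-- Formulas of Visser's basic propositional logic `BPL`. -/
inductive BPLForm (P : Type*) : Type _
  | var : P → BPLForm P
  | bot : BPLForm P
  | top : BPLForm P
  | and : BPLForm P → BPLForm P → BPLForm P
  | or : BPLForm P → BPLForm P → BPLForm P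
  | imp : BPLForm P → BPLForm P → BPLForm P

/-- Formulas of residuated basic logic `RBL`: `BPL` formulas plus `·` and `←`. -/
inductive RBLForm (P : Type*) : Type _
  | var : P → RBLForm P
  | bot : RBLForm P
  | top : RBLForm P
  | and : RBLForm P → RBLForm P → RBLForm P
  | or : RBLForm P → RBLForm P → RBLForm P
  | mul : RBLForm P → RBLForm P → RBLForm P
  | imp : RBLForm P → RBLForm P → RBLForm P
  | limp : RBLForm P → RBLForm P → RBLForm P

/-- The obvious embedding of `BPL` formulas into `RBL` formulas. -/
def BPLForm.toRBL {P : Type*} : BPLForm P → RBLForm P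
  | .var p => .var p
  | .bot => .bot
  | .top => .top
  | .and A B => .and A.toRBL B.toRBL
  | .or A B => .or A.toRBL B.toRBL
  | .imp A B => .imp A.toRBL B.toRBL

/-- A BPL-model: a nonempty set of states with a transitive relation and a
persistent valuation. -/
structure BPLModel (P : Type*) where
  W : Type
  nonempty : Nonempty W
  R : W → W → Prop
  trans : ∀ {x y z : W}, R x y → R y z → R x z
  V : P → W → Prop
  persistent : ∀ (p : P) {w u : W}, V p w → R w u → V p u

/-- Satisfaction in a BPL-model. -/
def BPLModel.Sat {P : Type*} (M : BPLModel P) : BPLForm P → M.W → Prop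
  | .var p, w => M.V p w
  | .bot, _ => False
  | .top, _ => True
  | .and A B, w => M.Sat A w ∧ M.Sat B w
  | .or A B, w => M.Sat A w ∨ M.Sat B w
  | .imp A B, w => ∀ v : M.W, M.R w v → M.Sat A v → M.Sat B v

/-- An `S*_RBL`-model: a set of states with a ternary relation and a valuation. -/
structure SStarModel (P : Type*) where
  W : Type
  R : W → W → W → Prop
  V : P → W → Prop

/-- Satisfaction of `RBL` formulas in an `S*_RBL`-model. -/
def SStarModel.Sat {P : Type*} (J : SStarModel P) : RBLForm P → J.W → Prop
  | .var p, a => J.V p a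
  | .bot, _ => False
  | .top, _ => True
  | .and A B, a => J.Sat A a ∧ J.Sat B a
  | .or A B, a => J.Sat A a ∨ J.Sat B a
  | .mul A B, a => ∃ a₂ a₃ : J.W, J.R a a₂ a₃ ∧ J.Sat A a₂ ∧ J.Sat B a₃
  | .imp A B, a => ∀ a₁ a₂ : J.W, J.R a₁ a₂ a → J.Sat A a₂ → J.Sat B a₁
  | .limp A B, a => ∀ a₁ a₃ : J.W, J.R a₁ a a₃ → J.Sat B a₃ → J.Sat A a₁

/-- The `S*_RBL`-model `J^M` induced by a BPL-model `M`: states are `M.W × Fin 2`,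
the ternary relation consists of the triples `((b,1),(b,2),(a,i))` and
`((b,2),(b,1),(a,i))` for `a R b`, and the valuation is copied in each copy. -/
def BPLModel.induced {P : Type*} (M : BPLModel P) : SStarModel P where
  W := M.W × Fin 2
  R := fun x y z => x.1 = y.1 ∧ x.2 ≠ y.2 ∧ M.R z.1 x.1
  V := fun p a => M.V p a.1

/-- Truth lemma: for every BPL formula `A`, state `a` and `i ∈ {1,2}`,
`M, a ⊨ A` iff `J^M, (a,i) ⊨ A`. -/
theorem induced_truth_lemma {P : Type*} (M : BPLModel P) (A : BPLForm P)
    (a : M.W) (i : Fin 2) :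
    M.Sat A a ↔ M.induced.Sat A.toRBL (a, i) := by
  induction A generalizing a i with
  | var p => exact Iff.rfl
  | bot => exact Iff.rfl
  | top => exact Iff.rfl
  | and A B ihA ihB => exact and_congr (ihA a i) (ihB a i)
  | or A B ihA ihB => exact or_congr (ihA a i) (ihB a i)
  | imp A B ihA ihB =>
    constructor
    · rintro h ⟨b, j⟩ ⟨c, k⟩ ⟨hbc, -, hab⟩ hA
      obtain rfl : b = c := hbc
      exact (ihB b j).1 (h b hab ((ihA b k).2 hA))
    · intro h b hab hA
      exact (ihB b 0).2 (h (b, 0) (b, 1) ⟨rfl, zero_ne_one, hab⟩ ((ihA b 1).1 hA))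
end

section
/- Let M be a BPL-model and let J^M be the induced S*_RBL-model. For all BPL formulas A and B, if the sequent A ⇒ B is derivable in S*_RBL, then A ⇒ B is true at every state of J^M, i.e., every state of J^M satisfying A also satisfies B. -/
/-- Derivability of simple sequents `A ⇒ B` in the system `S*_RBL`. -/
inductive SStarDeriv {P : Type*} : RBLForm P → RBLForm P → Prop
  | id (A : RBLForm P) : SStarDeriv A A
  | bot (A : RBLForm P) : SStarDeriv .bot A
  | top (A : RBLForm P) : SStarDeriv A .top
  | distrib (A B C : RBLForm P) :
      SStarDeriv (.and A (.or B C)) (.or (.and A B) (.and A C))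
  | top1 (A : RBLForm P) : SStarDeriv .top (.imp A A)
  | top2 (A : RBLForm P) : SStarDeriv A (.imp .top A)
  | tr (A B C : RBLForm P) : SStarDeriv (.and (.imp A B) (.imp B C)) (.imp A C)
  | cut {A B C : RBLForm P} : SStarDeriv A B → SStarDeriv B C → SStarDeriv A C
  | r1 {A B C : RBLForm P} : SStarDeriv (.mul A B) C → SStarDeriv B (.imp A C)
  | r2 {A B C : RBLForm P} : SStarDeriv B (.imp A C) → SStarDeriv (.mul A B) C
  | r3 {A B C : RBLForm P} : SStarDeriv (.mul A B) C → SStarDeriv A (.limp C B)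
  | r4 {A B C : RBLForm P} : SStarDeriv A (.limp C B) → SStarDeriv (.mul A B) C
  | andL1 {A₁ B : RBLForm P} (A₂ : RBLForm P) :
      SStarDeriv A₁ B → SStarDeriv (.and A₁ A₂) B
  | andL2 {A₂ B : RBLForm P} (A₁ : RBLForm P) :
      SStarDeriv A₂ B → SStarDeriv (.and A₁ A₂) B
  | andR {C A B : RBLForm P} : SStarDeriv C A → SStarDeriv C B → SStarDeriv C (.and A B)
  | orL {A B C : RBLForm P} : SStarDeriv A C → SStarDeriv B C → SStarDeriv (.or A B) C
  | orR1 {C A₁ : RBLForm P} (A₂ : RBLForm P) : SStarDeriv C A₁ → SStarDeriv C (.or A₁ A₂)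
  | orR2 {C A₂ : RBLForm P} (A₁ : RBLForm P) : SStarDeriv C A₂ → SStarDeriv C (.or A₁ A₂)

/-- Persistent satisfaction of `RBL` formulas in a BPL-model: `·` and `←` are read as the
residuals of `→` in the lattice of upsets. In particular `←` quantifies over the reflexive
closure of the accessibility relation, so that it is persistent; in `M.induced` it need not be. -/
def BPLModel.ResSat {P : Type*} (M : BPLModel P) : RBLForm P → M.W → Prop
  | .var p, w => M.V p w
  | .bot, _ => False
  | .top, _ => True
  | .and A B, w => M.ResSat A w ∧ M.ResSat B w
  | .or A B, w => M.ResSat A w ∨ M.ResSat B w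
  | .mul A B, w => M.ResSat A w ∧ ∃ u, M.R u w ∧ M.ResSat B u
  | .imp A B, w => ∀ v, M.R w v → M.ResSat A v → M.ResSat B v
  | .limp A B, w => ∀ v, w = v ∨ M.R w v → (∃ u, M.R u v ∧ M.ResSat B u) → M.ResSat A v

theorem BPLModel.ResSat.mono {P : Type*} {M : BPLModel P} {A : RBLForm P} {w v : M.W}
    (hA : M.ResSat A w) (hwv : M.R w v) : M.ResSat A v := by
  induction A with
  | var p => exact M.persistent p hA hwv
  | bot => exact hA
  | top => trivial
  | and A B ihA ihB => exact ⟨ihA hA.1, ihB hA.2⟩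
  | or A B ihA ihB => exact hA.imp ihA ihB
  | mul A B ihA _ =>
    obtain ⟨h, u, huw, hu⟩ := hA
    exact ⟨ihA h, u, M.trans huw hwv, hu⟩
  | imp A B _ _ => exact fun x hvx => hA x (M.trans hwv hvx)
  | limp A B _ _ =>
    rintro x (rfl | hvx)
    · exact hA v (.inr hwv)
    · exact hA x (.inr (M.trans hwv hvx))

theorem SStarDeriv.resSat {P : Type*} {A B : RBLForm P} (h : SStarDeriv A B)
    (M : BPLModel P) {w : M.W} (hA : M.ResSat A w) : M.ResSat B w := by
  induction h generalizing w with
  | id A => exact hA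
  | bot A => exact hA.elim
  | top A => trivial
  | distrib A B C => exact hA.2.imp (⟨hA.1, ·⟩) (⟨hA.1, ·⟩)
  | top1 A => exact fun _ _ h => h
  | top2 A => exact fun _ hwv _ => hA.mono hwv
  | tr A B C => exact fun v hwv h => hA.2 v hwv (hA.1 v hwv h)
  | cut _ _ ih₁ ih₂ => exact ih₂ (ih₁ hA)
  | r1 _ ih => exact fun v hwv h => ih ⟨h, w, hwv, hA⟩
  | r2 _ ih =>
    obtain ⟨h, u, huw, hu⟩ := hA
    exact ih hu w huw h
  | r3 _ ih =>
    rintro v (rfl | hwv) hB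
    · exact ih ⟨hA, hB⟩
    · exact ih ⟨hA.mono hwv, hB⟩
  | r4 _ ih => exact ih hA.1 w (.inl rfl) hA.2
  | andL1 _ _ ih => exact ih hA.1
  | andL2 _ _ ih => exact ih hA.2
  | andR _ _ ih₁ ih₂ => exact ⟨ih₁ hA, ih₂ hA⟩
  | orL _ _ ih₁ ih₂ => exact hA.elim ih₁ ih₂
  | orR1 _ _ ih => exact .inl (ih hA)
  | orR2 _ _ ih => exact .inr (ih hA)

theorem BPLModel.induced_sat_toRBL_iff {P : Type*} (M : BPLModel P) (A : BPLForm P)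
    (a : M.induced.W) : M.induced.Sat A.toRBL a ↔ M.ResSat A.toRBL a.1 := by
  induction A generalizing a with
  | var p => exact Iff.rfl
  | bot => exact Iff.rfl
  | top => exact Iff.rfl
  | and A B ihA ihB => exact and_congr (ihA a) (ihB a)
  | or A B ihA ihB => exact or_congr (ihA a) (ihB a)
  | imp A B ihA ihB =>
    constructor
    · intro h v hv hA
      exact (ihB (v, 0)).1 (h (v, 0) (v, 1) ⟨rfl, zero_ne_one, hv⟩ ((ihA (v, 1)).2 hA))
    · rintro h ⟨v, i⟩ ⟨u, j⟩ ⟨rfl : v = u, _, hv⟩ hA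
      exact (ihB (v, i)).2 (h v hv ((ihA (v, j)).1 hA))

/-- If `A ⇒ B` (with `A`, `B` BPL formulas) is derivable in `S*_RBL`, then it is
true at every state of the induced model `J^M`. -/
theorem sstar_sound_in_induced {P : Type*} (M : BPLModel P) (A B : BPLForm P)
    (h : SStarDeriv A.toRBL B.toRBL) :
    ∀ a : M.induced.W, M.induced.Sat A.toRBL a → M.induced.Sat B.toRBL a := by
  intro a hA
  exact (M.induced_sat_toRBL_iff B a).2 (h.resSat M ((M.induced_sat_toRBL_iff A a).1 hA))
end

section
/- The systems S_RBL and S*_RBL are equivalent: for all RBL formulas A and B, the sequent A ⇒ B is derivable in S_RBL if and only if it is derivable in S*_RBL. -/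
/-- Derivability of simple sequents `A ⇒ B` in the algebraic system `S_RBL`. -/
inductive SDeriv {P : Type*} : RBLForm P → RBLForm P → Prop
  | id (A : RBLForm P) : SDeriv A A
  | bot (A : RBLForm P) : SDeriv .bot A
  | top (A : RBLForm P) : SDeriv A .top
  | distrib (A B C : RBLForm P) :
      SDeriv (.and A (.or B C)) (.or (.and A B) (.and A C))
  | wl (A : RBLForm P) : SDeriv (.mul A .top) A
  | wr (A : RBLForm P) : SDeriv (.mul .top A) A
  | rc (A B : RBLForm P) : SDeriv (.mul A B) (.mul (.mul A B) B)
  | cut {A B C : RBLForm P} : SDeriv A B → SDeriv B C → SDeriv A C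
  | r1 {A B C : RBLForm P} : SDeriv (.mul A B) C → SDeriv B (.imp A C)
  | r2 {A B C : RBLForm P} : SDeriv B (.imp A C) → SDeriv (.mul A B) C
  | r3 {A B C : RBLForm P} : SDeriv (.mul A B) C → SDeriv A (.limp C B)
  | r4 {A B C : RBLForm P} : SDeriv A (.limp C B) → SDeriv (.mul A B) C
  | andL1 {A₁ B : RBLForm P} (A₂ : RBLForm P) : SDeriv A₁ B → SDeriv (.and A₁ A₂) B
  | andL2 {A₂ B : RBLForm P} (A₁ : RBLForm P) : SDeriv A₂ B → SDeriv (.and A₁ A₂) B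
  | andR {C A B : RBLForm P} : SDeriv C A → SDeriv C B → SDeriv C (.and A B)
  | orL {A B C : RBLForm P} : SDeriv A C → SDeriv B C → SDeriv (.or A B) C
  | orR1 {C A₁ : RBLForm P} (A₂ : RBLForm P) : SDeriv C A₁ → SDeriv C (.or A₁ A₂)
  | orR2 {C A₂ : RBLForm P} (A₁ : RBLForm P) : SDeriv C A₂ → SDeriv C (.or A₁ A₂)

theorem SDeriv.mul_mono_left {P : Type*} {A B : RBLForm P} (C : RBLForm P)
    (h : SDeriv A B) : SDeriv (.mul A C) (.mul B C) :=
  .r4 (.cut h (.r3 (.id _)))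

/-- `(Tr)` is derivable in `S_RBL`. -/
theorem SDeriv.imp_trans {P : Type*} (A B C : RBLForm P) :
    SDeriv (.and (.imp A B) (.imp B C)) (.imp A C) :=
  .r1 (.cut (.rc _ _) (.cut (.mul_mono_left _ (.r2 (.andL1 _ (.id _))))
    (.r2 (.andL2 _ (.id _)))))

/-- `(RC)` is derivable in `S*_RBL`. -/
theorem SStarDeriv.mul_contraction {P : Type*} (A B : RBLForm P) :
    SStarDeriv (.mul A B) (.mul (.mul A B) B) :=
  .r2 (.cut (.andR (.r1 (.id _)) (.r1 (.id _))) (.tr A (.mul A B) _))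

theorem SDeriv.toSStarDeriv {P : Type*} {A B : RBLForm P} (h : SDeriv A B) :
    SStarDeriv A B := by
  induction h with
  | id => exact .id _
  | bot => exact .bot _
  | top => exact .top _
  | distrib => exact .distrib _ _ _
  | wl => exact .r2 (.top1 _)
  | wr => exact .r2 (.top2 _)
  | rc => exact .mul_contraction _ _
  | cut _ _ h₁ h₂ => exact .cut h₁ h₂
  | r1 _ h => exact .r1 h
  | r2 _ h => exact .r2 h
  | r3 _ h => exact .r3 h
  | r4 _ h => exact .r4 h
  | andL1 _ _ h => exact .andL1 _ h
  | andL2 _ _ h => exact .andL2 _ h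
  | andR _ _ h₁ h₂ => exact .andR h₁ h₂
  | orL _ _ h₁ h₂ => exact .orL h₁ h₂
  | orR1 _ _ h => exact .orR1 _ h
  | orR2 _ _ h => exact .orR2 _ h

theorem SStarDeriv.toSDeriv {P : Type*} {A B : RBLForm P} (h : SStarDeriv A B) :
    SDeriv A B := by
  induction h with
  | id => exact .id _
  | bot => exact .bot _
  | top => exact .top _
  | distrib => exact .distrib _ _ _
  | top1 => exact .r1 (.wl _)
  | top2 => exact .r1 (.wr _)
  | tr => exact .imp_trans _ _ _
  | cut _ _ h₁ h₂ => exact .cut h₁ h₂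
  | r1 _ h => exact .r1 h
  | r2 _ h => exact .r2 h
  | r3 _ h => exact .r3 h
  | r4 _ h => exact .r4 h
  | andL1 _ _ h => exact .andL1 _ h
  | andL2 _ _ h => exact .andL2 _ h
  | andR _ _ h₁ h₂ => exact .andR h₁ h₂
  | orL _ _ h₁ h₂ => exact .orL h₁ h₂
  | orR1 _ _ h => exact .orR1 _ h
  | orR2 _ _ h => exact .orR2 _ h

/-- The systems `S_RBL` and `S*_RBL` are equivalent. -/
theorem sderiv_iff_sstarderiv {P : Type*} (A B : RBLForm P) :
    SDeriv A B ↔ SStarDeriv A B :=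
  ⟨SDeriv.toSStarDeriv, SStarDeriv.toSDeriv⟩
end

section
/- For every BPL formula A: A is valid in every basic algebra (i.e., every homomorphic assignment of BPL formulas into any basic algebra sends A to ⊤) if and only if A is valid in every residuated basic algebra (i.e., every homomorphic assignment of RBL formulas into any residuated basic algebra sends A to ⊤). -/
/-- A basic algebra: a bounded distributive lattice with a binary operation `imp`
satisfying the five axioms of basic implication. -/
class BasicAlgebra (A : Type*) extends DistribLattice A, BoundedOrder A where
  imp : A → A → A
  imp_inf : ∀ a b c : A, imp a (b ⊓ c) = imp a b ⊓ imp a c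
  sup_imp : ∀ a b c : A, imp (b ⊔ c) a = imp b a ⊓ imp c a
  imp_self : ∀ a : A, imp a a = ⊤
  le_top_imp : ∀ a : A, a ≤ imp ⊤ a
  imp_trans : ∀ a b c : A, imp a b ⊓ imp b c ≤ imp a c

/-- Homomorphic evaluation of a BPL formula in a basic algebra under an assignment. -/
def BPLForm.evalBA {P : Type*} {A : Type*} [BasicAlgebra A] (σ : P → A) : BPLForm P → A
  | .var p => σ p
  | .bot => ⊥
  | .top => ⊤
  | .and B C => B.evalBA σ ⊓ C.evalBA σ
  | .or B C => B.evalBA σ ⊔ C.evalBA σ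
  | .imp B C => BasicAlgebra.imp (B.evalBA σ) (C.evalBA σ)

/-- Homomorphic evaluation of an RBL formula in a residuated basic algebra under an
assignment. -/
def RBLForm.evalRBA {P : Type*} {L : Type*} [ResiduatedBasicAlgebra L] (σ : P → L) :
    RBLForm P → L
  | .var p => σ p
  | .bot => ⊥
  | .top => ⊤
  | .and B C => B.evalRBA σ ⊓ C.evalRBA σ
  | .or B C => B.evalRBA σ ⊔ C.evalRBA σ
  | .mul B C => ResiduatedBasicAlgebra.mul (B.evalRBA σ) (C.evalRBA σ)
  | .imp B C => ResiduatedBasicAlgebra.rimp (B.evalRBA σ) (C.evalRBA σ)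
  | .limp B C => ResiduatedBasicAlgebra.limp (B.evalRBA σ) (C.evalRBA σ)

/-- The product-free reduct of a residuated basic algebra is a basic algebra. -/
@[reducible]
def ResiduatedBasicAlgebra.toBasicAlgebra (L : Type*) [ResiduatedBasicAlgebra L] :
    BasicAlgebra L where
  imp := rimp
  imp_inf a b c := eq_of_forall_le_iff fun x => by simp only [le_inf_iff, ← res_r]
  sup_imp a b c := eq_of_forall_le_iff fun x => by
    simp only [le_inf_iff, ← res_r]
    simp only [res_l, sup_le_iff]
  imp_self a := top_le_iff.1 <| (res_r _ _ _).1 (w₁ a)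
  le_top_imp a := (res_r _ _ _).1 (w₂ a)
  imp_trans a b c := by
    refine (res_r _ _ _).1 ((c_r _ _).trans ?_)
    rw [res_l]
    refine ((res_r a _ b).2 inf_le_left).trans ?_
    rw [← res_l]
    exact (res_r _ _ _).2 inf_le_right

theorem BPLForm.evalRBA_toRBL {P L : Type*} [ResiduatedBasicAlgebra L] (σ : P → L)
    (A : BPLForm P) :
    A.toRBL.evalRBA σ =
      @BPLForm.evalBA P L (ResiduatedBasicAlgebra.toBasicAlgebra L) σ A := by
  induction A with
  | var p => rfl
  | bot => rfl
  | top => rfl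
  | and B C hB hC => simp only [toRBL, RBLForm.evalRBA, hB, hC, evalBA]
  | or B C hB hC => simp only [toRBL, RBLForm.evalRBA, hB, hC, evalBA]
  | imp B C hB hC =>
    simp only [toRBL, RBLForm.evalRBA, hB, hC, evalBA]
    rfl

/-- Prime filter theorem relative to a transitive relation `r` that extends the order of a
distributive lattice and is compatible with its operations. -/
theorem exists_prime_filter_of_not_rel {α : Type*} [DistribLattice α] {r : α → α → Prop}
    (of_le : ∀ {a b}, a ≤ b → r a b) (trans : ∀ {a b c}, r a b → r b c → r a c)
    (inf : ∀ {a b c}, r a b → r a c → r a (b ⊓ c))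
    (sup : ∀ {a b c}, r a c → r b c → r (a ⊔ b) c) {a b : α} (hab : ¬ r a b) :
    ∃ G : Set α, (∀ x y, r x y → x ∈ G → y ∈ G) ∧ (∀ x ∈ G, ∀ y ∈ G, x ⊓ y ∈ G) ∧
      (∀ x y, x ⊔ y ∈ G → x ∈ G ∨ y ∈ G) ∧ a ∈ G ∧ b ∉ G := by
  let S : Set (Set α) := {G | (∀ x y, r x y → x ∈ G → y ∈ G) ∧
    (∀ x ∈ G, ∀ y ∈ G, x ⊓ y ∈ G) ∧ b ∉ G}
  have h₀ : {x | r a x} ∈ S :=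
    ⟨fun x y hxy hx => trans hx hxy, fun x hx y hy => inf hx hy, hab⟩
  obtain ⟨M, haM, hM⟩ := zorn_subset_nonempty S (fun c hcS hc hne => by
    refine ⟨⋃₀ c, ⟨?_, ?_, ?_⟩, fun s hs => Set.subset_sUnion_of_mem hs⟩
    · rintro x y hxy ⟨G, hG, hx⟩
      exact ⟨G, hG, (hcS hG).1 x y hxy hx⟩
    · rintro x ⟨G, hG, hx⟩ y ⟨H, hH, hy⟩
      rcases hc.total hG hH with h | h
      · exact ⟨H, hH, (hcS hH).2.1 x (h hx) y hy⟩
      · exact ⟨G, hG, (hcS hG).2.1 x hx y (h hy)⟩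
    · rintro ⟨G, hG, hb⟩
      exact (hcS hG).2.2 hb) _ h₀
  obtain ⟨hcl, hinf, hb⟩ := hM.prop
  have ha : a ∈ M := haM (of_le le_rfl)
  have extend : ∀ x ∉ M, ∃ g ∈ M, r (g ⊓ x) b := by
    intro x hx
    by_contra! h
    have hN : {y | ∃ g ∈ M, r (g ⊓ x) y} ∈ S := by
      refine ⟨?_, ?_, ?_⟩
      · rintro y z hyz ⟨g, hg, hy⟩
        exact ⟨g, hg, trans hy hyz⟩
      · rintro y ⟨g, hg, hy⟩ z ⟨k, hk, hz⟩
        exact ⟨g ⊓ k, hinf g hg k hk,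
          inf (trans (of_le (inf_le_inf_right x inf_le_left)) hy)
            (trans (of_le (inf_le_inf_right x inf_le_right)) hz)⟩
      · rintro ⟨g, hg, hgb⟩
        exact h g hg hgb
    exact hx (hM.le_of_ge hN (fun y hy => ⟨y, hy, of_le inf_le_left⟩)
      ⟨a, ha, of_le inf_le_right⟩)
  refine ⟨M, hcl, hinf, fun x y hxy => ?_, ha, hb⟩
  by_contra! h
  obtain ⟨g, hg, hgx⟩ := extend x h.1
  obtain ⟨k, hk, hky⟩ := extend y h.2
  refine hb (hcl _ _ ?_ (hinf _ (hinf g hg k hk) _ hxy))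
  rw [inf_sup_left]
  exact sup (trans (of_le (inf_le_inf_right x inf_le_left)) hgx)
    (trans (of_le (inf_le_inf_right y inf_le_right)) hky)

namespace BasicAlgebra

variable {A : Type*} [BasicAlgebra A]

theorem imp_eq_top_of_le {a b : A} (h : a ≤ b) : imp a b = ⊤ := by
  have := imp_inf a a b
  rwa [inf_eq_left.2 h, imp_self, top_inf_eq, eq_comm] at this

/-- Proper prime filters of a basic algebra. -/
structure PrimeFilter (A : Type*) [BasicAlgebra A] where
  carrier : Set A
  mem_of_le' : ∀ x y, x ≤ y → x ∈ carrier → y ∈ carrier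
  inf_mem' : ∀ x ∈ carrier, ∀ y ∈ carrier, x ⊓ y ∈ carrier
  prime' : ∀ x y, x ⊔ y ∈ carrier → x ∈ carrier ∨ y ∈ carrier
  top_mem' : ⊤ ∈ carrier
  bot_notMem' : ⊥ ∉ carrier

namespace PrimeFilter

/-- The accessibility relation of the canonical frame. -/
def Rel (F G : PrimeFilter A) : Prop :=
  ∀ a b, imp a b ∈ F.carrier → a ∈ G.carrier → b ∈ G.carrier

theorem Rel.subset {F G : PrimeFilter A} (h : F.Rel G) : F.carrier ⊆ G.carrier :=
  fun a ha => h ⊤ a (F.mem_of_le' _ _ (le_top_imp a) ha) G.top_mem'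

theorem Rel.trans {F G H : PrimeFilter A} (h : F.Rel G) (h' : G.Rel H) : F.Rel H :=
  fun a b hab => h' a b (h.subset hab)

/-- The converse of the reflexive closure of accessibility, so that lower sets are the sets
persistent along accessibility. -/
instance : Preorder (PrimeFilter A) where
  le G F := G = F ∨ F.Rel G
  le_refl F := Or.inl rfl
  le_trans := by
    rintro H G F (rfl | h) (rfl | h')
    · exact Or.inl rfl
    · exact Or.inr h'
    · exact Or.inr h
    · exact Or.inr (h'.trans h)

theorem Rel.le {F G : PrimeFilter A} (h : F.Rel G) : G ≤ F := Or.inr h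

theorem Rel.trans_le {F G H : PrimeFilter A} (h : F.Rel G) (h' : H ≤ G) : F.Rel H := by
  rcases h' with rfl | h'
  · exact h
  · exact h.trans h'

theorem subset_of_le {F G : PrimeFilter A} (h : G ≤ F) : F.carrier ⊆ G.carrier := by
  rcases h with rfl | h
  · exact subset_rfl
  · exact h.subset

/-- The residuated basic algebra of persistent sets of the canonical frame. -/
instance : ResiduatedBasicAlgebra (LowerSet (PrimeFilter A)) where
  toDistribLattice := inferInstance
  toBoundedOrder := inferInstance
  mul U V := ⟨{G | G ∈ U ∧ ∃ F ∈ V, F.Rel G},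
    fun _ _ h ⟨hU, F, hF, hFG⟩ => ⟨U.lower h hU, F, hF, hFG.trans_le h⟩⟩
  rimp U C := ⟨{F | ∀ G, F.Rel G → G ∈ U → G ∈ C}, fun F F' h hF G hG => by
    rcases h with rfl | h
    · exact hF G hG
    · exact hF G (h.trans hG)⟩
  limp C V := ⟨{G | ∀ H ≤ G, (∃ F ∈ V, F.Rel H) → H ∈ C},
    fun _ _ h hG H hH => hG H (hH.trans h)⟩
  res_r U V C := ⟨fun h F hF G hFG hG => h ⟨hG, F, hF, hFG⟩,
    fun h G ⟨hG, _, hF, hFG⟩ => h hF G hFG hG⟩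
  res_l U V C := ⟨fun h G hG _ hH hF => h ⟨U.lower hH hG, hF⟩,
    fun h G ⟨hG, hF⟩ => h hG G le_rfl hF⟩
  w₁ _ _ h := h.1
  w₂ U _ := fun ⟨_, _, hF, hFG⟩ => U.lower hFG.le hF
  c_r _ _ _ h := ⟨h, h.2⟩

/-- The persistent set of prime filters containing a given element. -/
def basic (a : A) : LowerSet (PrimeFilter A) :=
  ⟨{F | a ∈ F.carrier}, fun _ _ h ha => subset_of_le h ha⟩

theorem basic_bot : basic (⊥ : A) = ⊥ := by
  ext F
  exact iff_of_false F.bot_notMem' (LowerSet.notMem_bot)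

theorem basic_top : basic (⊤ : A) = ⊤ := by
  ext F
  exact iff_of_true F.top_mem' trivial

theorem basic_inf (a b : A) : basic (a ⊓ b) = basic a ⊓ basic b := by
  ext F
  exact ⟨fun h => ⟨F.mem_of_le' _ _ inf_le_left h, F.mem_of_le' _ _ inf_le_right h⟩,
    fun h => F.inf_mem' _ h.1 _ h.2⟩

theorem basic_sup (a b : A) : basic (a ⊔ b) = basic a ⊔ basic b := by
  ext F
  exact ⟨fun h => F.prime' _ _ h,
    fun h => h.elim (F.mem_of_le' _ _ le_sup_left) (F.mem_of_le' _ _ le_sup_right)⟩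

theorem exists_mem_notMem_of_not_le {a b : A} (h : ¬ a ≤ b) :
    ∃ F : PrimeFilter A, a ∈ F.carrier ∧ b ∉ F.carrier := by
  obtain ⟨G, hcl, hinf, hpr, ha, hb⟩ :=
    exists_prime_filter_of_not_rel (r := fun x y : A => x ≤ y) id le_trans le_inf sup_le h
  exact ⟨⟨G, hcl, hinf, hpr, hcl _ _ le_top ha, fun h => hb (hcl _ _ bot_le h)⟩, ha, hb⟩

theorem exists_rel_of_imp_notMem {F : PrimeFilter A} {a b : A} (h : imp a b ∉ F.carrier) :
    ∃ G : PrimeFilter A, F.Rel G ∧ a ∈ G.carrier ∧ b ∉ G.carrier := by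
  have of_le : ∀ {x y : A}, x ≤ y → imp x y ∈ F.carrier := fun hxy => by
    rw [imp_eq_top_of_le hxy]
    exact F.top_mem'
  obtain ⟨G, hcl, hinf, hpr, ha, hb⟩ :=
    exists_prime_filter_of_not_rel (r := fun x y : A => imp x y ∈ F.carrier) of_le
      (fun hxy hyz => F.mem_of_le' _ _ (imp_trans _ _ _) (F.inf_mem' _ hxy _ hyz))
      (fun hxy hxz => by rw [imp_inf]; exact F.inf_mem' _ hxy _ hxz)
      (fun hxz hyz => by rw [sup_imp]; exact F.inf_mem' _ hxz _ hyz) h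
  exact ⟨⟨G, fun x y hxy => hcl x y (of_le hxy), hinf, hpr, hcl _ _ (of_le le_top) ha,
    fun h => hb (hcl _ _ (of_le bot_le) h)⟩, hcl, ha, hb⟩

theorem basic_imp (a b : A) :
    basic (imp a b) = ResiduatedBasicAlgebra.rimp (basic a) (basic b) := by
  ext F
  refine ⟨fun h G hG ha => hG a b h ha, fun h => ?_⟩
  by_contra hF
  obtain ⟨G, hG, ha, hb⟩ := exists_rel_of_imp_notMem hF
  exact hb (h G hG ha)

theorem eq_top_of_basic_eq_top {a : A} (h : basic a = ⊤) : a = ⊤ := by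
  by_contra ha
  obtain ⟨F, -, hF⟩ := exists_mem_notMem_of_not_le (mt top_le_iff.1 ha)
  have : F ∈ basic a := h ▸ LowerSet.mem_top
  exact hF this

theorem evalRBA_basic {P : Type*} (σ : P → A) (B : BPLForm P) :
    B.toRBL.evalRBA (fun p => basic (σ p)) = basic (B.evalBA σ) := by
  induction B with
  | var p => rfl
  | bot => exact basic_bot.symm
  | top => exact basic_top.symm
  | and B C hB hC =>
    rw [BPLForm.evalBA, basic_inf, ← hB, ← hC]
    rfl
  | or B C hB hC =>
    rw [BPLForm.evalBA, basic_sup, ← hB, ← hC]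
    rfl
  | imp B C hB hC =>
    rw [BPLForm.evalBA, basic_imp, ← hB, ← hC]
    rfl

end PrimeFilter

end BasicAlgebra

/-- A BPL formula is valid in every basic algebra iff it is valid in every
residuated basic algebra. -/
theorem bla_valid_iff_rba_valid {P : Type*} (A : BPLForm P) :
    (∀ (L : Type) [BasicAlgebra L] (σ : P → L), A.evalBA σ = ⊤) ↔
    (∀ (L : Type) [ResiduatedBasicAlgebra L] (σ : P → L), A.toRBL.evalRBA σ = ⊤) := by
  refine ⟨fun h L _ σ => ?_, fun h L _ σ => ?_⟩
  · rw [BPLForm.evalRBA_toRBL]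
    exact @h L (ResiduatedBasicAlgebra.toBasicAlgebra L) σ
  · refine BasicAlgebra.PrimeFilter.eq_top_of_basic_eq_top ?_
    rw [← BasicAlgebra.PrimeFilter.evalRBA_basic]
    exact h _ _
end

section
/- BPL has the disjunction property: for all BPL formulas A and B, if ⊢_BPL A∨B, then ⊢_BPL A or ⊢_BPL B. -/
/-- Provability in the Hilbert system for Visser's basic propositional logic. -/
inductive BPLProv {P : Type*} : BPLForm P → Prop
  | ax1 (A : BPLForm P) : BPLProv (.imp A A)
  | ax2 (A B : BPLForm P) : BPLProv (.imp A (.imp B A))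
  | ax3 (A B C : BPLForm P) :
      BPLProv (.imp (.and (.imp A B) (.imp B C)) (.imp A C))
  | ax4 (A B C : BPLForm P) :
      BPLProv (.imp (.and (.imp A C) (.imp B C)) (.imp (.or A B) C))
  | ax5 (A B : BPLForm P) : BPLProv (.imp (.and A B) A)
  | ax6 (A B : BPLForm P) : BPLProv (.imp (.and A B) B)
  | ax7 (A B : BPLForm P) : BPLProv (.imp A (.or A B))
  | ax8 (A B : BPLForm P) : BPLProv (.imp B (.or A B))
  | ax9 (A B : BPLForm P) : BPLProv (.imp A (.imp B (.and A B)))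
  | ax10 (A B C : BPLForm P) :
      BPLProv (.imp (.and (.imp A B) (.imp A C)) (.imp A (.and B C)))
  | ax11 (A B C : BPLForm P) :
      BPLProv (.imp (.and A (.or B C)) (.or (.and A B) (.and A C)))
  | ax12 (A : BPLForm P) : BPLProv (.imp .bot A)
  | mp {A B : BPLForm P} : BPLProv A → BPLProv (.imp A B) → BPLProv B

/-- The Aczel slash for `BPL`: implications are required to be provable and to preserve the
slash. -/
def BPLSlash {P : Type*} : BPLForm P → Prop
  | .var p => BPLProv (.var p)
  | .bot => False
  | .top => BPLProv (.top : BPLForm P)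
  | .and A B => BPLSlash A ∧ BPLSlash B
  | .or A B => BPLSlash A ∨ BPLSlash B
  | .imp A B => BPLProv (.imp A B) ∧ (BPLSlash A → BPLSlash B)

theorem BPLSlash.prov {P : Type*} : ∀ {A : BPLForm P}, BPLSlash A → BPLProv A
  | .var _, h => h
  | .bot, h => h.elim
  | .top, h => h
  | .and A B, h => .mp h.2.prov (.mp h.1.prov (.ax9 A B))
  | .or A B, h => h.elim (fun h => .mp h.prov (.ax7 A B)) (fun h => .mp h.prov (.ax8 A B))
  | .imp _ _, h => h.1

/-- To slash a provable implication into an implication, only the innermost condition has to be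
checked. -/
theorem BPLSlash.imp_imp {P : Type*} {A B C : BPLForm P} (h : BPLProv (.imp A (.imp B C)))
    (hs : BPLSlash A → BPLSlash B → BPLSlash C) : BPLSlash (.imp A (.imp B C)) :=
  ⟨h, fun hA => ⟨.mp hA.prov h, hs hA⟩⟩

theorem BPLProv.slash {P : Type*} {A : BPLForm P} (h : BPLProv A) : BPLSlash A := by
  induction h with
  | ax1 A => exact ⟨.ax1 A, id⟩
  | ax2 A B => exact .imp_imp (.ax2 A B) fun hA _ => hA
  | ax3 A B C => exact .imp_imp (.ax3 A B C) fun h hA => h.2.2 (h.1.2 hA)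
  | ax4 A B C => exact .imp_imp (.ax4 A B C) fun h hAB => hAB.elim h.1.2 h.2.2
  | ax5 A B => exact ⟨.ax5 A B, And.left⟩
  | ax6 A B => exact ⟨.ax6 A B, And.right⟩
  | ax7 A B => exact ⟨.ax7 A B, Or.inl⟩
  | ax8 A B => exact ⟨.ax8 A B, Or.inr⟩
  | ax9 A B => exact .imp_imp (.ax9 A B) And.intro
  | ax10 A B C => exact .imp_imp (.ax10 A B C) fun h hA => ⟨h.1.2 hA, h.2.2 hA⟩
  | ax11 A B C => exact ⟨.ax11 A B C, and_or_left.mp⟩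
  | ax12 A => exact ⟨.ax12 A, False.elim⟩
  | mp _ _ hA hAB => exact hAB.2 hA

/-- Disjunction property of `BPL`: if `⊢_BPL A ∨ B`, then `⊢_BPL A` or `⊢_BPL B`. -/
theorem bpl_disjunction_property {P : Type*} (A B : BPLForm P)
    (h : BPLProv (.or A B)) :
    BPLProv A ∨ BPLProv B := by
  exact h.slash.imp BPLSlash.prov BPLSlash.prov
end
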